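/- Let N be a finite group with trivial center. Suppose there exist a positive integer k and an automorphism γ ∈ Aut(N) such that γ^k lies in the commutator subgroup of Inn(N) and (δγ)^k ≠ 1 for all δ ∈ Inn(N). Then Gaschütz' theorem does not hold for N. -/

import Mathlib

open Pointwise

/-- `K` is a complement of `N` inside the subgroup `H` of `G`:
`K ≤ H`, `K ∩ N = 1` and `KN = H` (as sets). -/
def IsComplementOfIn {G : Type*} [Group G] (K N H : Subgroup G) : Prop :=
  K ≤ H ∧ K ⊓ N = ⊥ ∧ (K : Set G) * (N : Set G) = (H : Set G)

/-- `N` has a complement in the subgroup `H` of `G`. -/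
def HasComplementIn {G : Type*} [Group G] (N H : Subgroup G) : Prop :=
  ∃ K : Subgroup G, IsComplementOfIn K N H

universe u

/-- Gaschütz' theorem holds for the finite group `N`: whenever `N` is embedded as a
normal subgroup of a finite group `G`, `H` is a subgroup with `N ≤ H ≤ G`,
`gcd(|N|, [G : H]) = 1` and `N` has a complement in `H`, then `N` has a complement
in `G`. -/
def GaschuetzHolds (N : Type u) [Group N] : Prop :=
  ∀ (G : Type u) [Group G] [Finite G] (f : N →* G) (H : Subgroup G),
    Function.Injective f → f.range.Normal → f.range ≤ H →
    Nat.Coprime (Nat.card N) H.index →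
    HasComplementIn f.range H → HasComplementIn f.range ⊤

namespace RegularWreathProduct

variable {D Q : Type*} [Group D] [Group Q]

/-- The embedding of the base group `Q → D` into the regular wreath product `D ≀ᵣ Q`. -/
def baseHom : (Q → D) →* D ≀ᵣ Q where
  toFun x := ⟨x, 1⟩
  map_one' := rfl
  map_mul' x y := by ext <;> simp

@[simp]
theorem baseHom_left (x : Q → D) : (baseHom x).left = x := rfl

@[simp]
theorem baseHom_right (x : Q → D) : (baseHom x).right = 1 := rfl

end RegularWreathProduct

open RegularWreathProduct
open scoped commutatorElement

theorem commutatorElement_mulSingle_div {A C : Type*} [Group A] [DecidableEq C]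
    {i j l : C} (hij : i ≠ j) (hil : i ≠ l) (hjl : j ≠ l) (u v : A) :
    ⁅(Pi.mulSingle i u / Pi.mulSingle j u : C → A), Pi.mulSingle i v / Pi.mulSingle l v⁆ =
      (Pi.mulSingle i ⁅u, v⁆ : C → A) := by
  ext m
  rcases eq_or_ne m i with rfl | hmi
  · simp [commutatorElement_def, hij, hil]
  rcases eq_or_ne m j with rfl | hmj
  · simp [commutatorElement_def, hmi, hjl]
  · simp [commutatorElement_def, hmi, hmj]

section FiberWreath

variable {A : Type*} [Group A]

/-- The pairs `(a, w)` in `A × (A ≀ᵣ C)` such that `a` is congruent modulo `I` to every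
coordinate of `w`. -/
def fiberWreath (I : Subgroup A) [I.Normal] (C : Type*) [Group C] :
    Subgroup (A × (A ≀ᵣ C)) where
  carrier := {p | ∀ i, (p.1 : A ⧸ I) = p.2.left i}
  one_mem' i := rfl
  mul_mem' {p q} hp hq i := by
    have h₁ := hp i
    have h₂ := hq (p.2.right⁻¹ * i)
    simp [h₁, h₂]
  inv_mem' {p} hp i := by
    have h := hp (p.2.right * i)
    simp [h]

variable {I : Subgroup A} [I.Normal] {C : Type*} [Group C]

theorem mem_fiberWreath {p : A × (A ≀ᵣ C)} :
    p ∈ fiberWreath I C ↔ ∀ i, (p.1 : A ⧸ I) = p.2.left i := Iff.rfl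

/-- A subgroup `K` that meets `I × 1` trivially and meets every coset of `I × 1` in
`fiberWreath I C` contains the conjugates of `C` by elements of `I ^ C`. -/
theorem one_conj_inl_mem [Finite C] (hcop : (Nat.card I).Coprime (Nat.card C))
    {K : Subgroup (A × (A ≀ᵣ C))} (hinf : ∀ a ∈ I, (a, 1) ∈ K → a = 1)
    (hsup : ∀ p ∈ fiberWreath I C, ∃ u ∈ I, (u * p.1, p.2) ∈ K)
    {x : C → A} (hx : ∀ i, x i ∈ I) (c : C) :
    ((1, baseHom x * inl c * (baseHom x)⁻¹) : A × (A ≀ᵣ C)) ∈ K := by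
  obtain ⟨u, hu, hK⟩ := hsup (1, baseHom x * inl c * (baseHom x)⁻¹) (fun i => by
    have h (j : C) : (x j : A ⧸ I) = 1 := (QuotientGroup.eq_one_iff _).2 (hx j)
    simp [h])
  rw [mul_one] at hK
  have hpow : u ^ Nat.card C = 1 := by
    refine hinf _ (I.pow_mem hu _) ?_
    have h := K.pow_mem hK (Nat.card C)
    rwa [Prod.pow_mk, conj_pow, ← map_pow, pow_card_eq_one', map_one, mul_one,
      mul_inv_cancel] at h
  have hu1 : u = 1 := by
    rw [← orderOf_eq_one_iff, ← Nat.dvd_one, ← hcop.gcd_eq_one]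
    exact Nat.dvd_gcd (I.orderOf_dvd_natCard hu) (orderOf_dvd_of_pow_eq_one hpow)
  rwa [hu1] at hK

theorem one_baseHom_mulSingle_div_mem [DecidableEq C] [Finite C]
    (hcop : (Nat.card I).Coprime (Nat.card C))
    {K : Subgroup (A × (A ≀ᵣ C))} (hinf : ∀ a ∈ I, (a, 1) ∈ K → a = 1)
    (hsup : ∀ p ∈ fiberWreath I C, ∃ u ∈ I, (u * p.1, p.2) ∈ K)
    {u : A} (hu : u ∈ I) (i j : C) :
    ((1, baseHom (Pi.mulSingle i u / Pi.mulSingle j u)) : A × (A ≀ᵣ C)) ∈ K := by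
  have hx (l : C) : (Pi.mulSingle i u : C → A) l ∈ I := by
    rcases eq_or_ne l i with rfl | h
    · simpa using hu
    · simp [Pi.mulSingle_eq_of_ne h, I.one_mem]
  have h₁ := one_conj_inl_mem hcop hinf hsup hx (j * i⁻¹)
  have h₂ := one_conj_inl_mem hcop hinf hsup (x := 1) (fun _ => I.one_mem) (j * i⁻¹)
  convert K.div_mem h₁ h₂ using 1
  refine Prod.ext (by simp) ?_
  ext l
  · simp [div_eq_mul_inv, Pi.mulSingle_apply, inv_mul_eq_iff_eq_mul, mul_assoc]
  · simp [div_eq_mul_inv]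

theorem exists_mul_pow_eq_one_of_complement [Finite C] (hC : 2 < Nat.card C)
    (hcop : (Nat.card I).Coprime (Nat.card C))
    {K : Subgroup (A × (A ≀ᵣ C))} (hinf : ∀ a ∈ I, (a, 1) ∈ K → a = 1)
    (hsup : ∀ p ∈ fiberWreath I C, ∃ u ∈ I, (u * p.1, p.2) ∈ K)
    {γ : A} {k : ℕ} (hγ : γ ^ k ∈ ⁅I, I⁆) : ∃ δ ∈ I, (δ * γ) ^ k = 1 := by
  classical
  let T : Subgroup (C → A) := K.comap ((MonoidHom.inr A (A ≀ᵣ C)).comp baseHom)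
  have hsingle (i : C) : ⁅I, I⁆ ≤ T.comap (MonoidHom.mulSingle (fun _ : C => A) i) := by
    have : Fintype C := Fintype.ofFinite C
    obtain ⟨j, l, hj, hl, hjl⟩ : ∃ j l : C, j ≠ i ∧ l ≠ i ∧ j ≠ l := by
      have h : 1 < (Finset.univ.erase i).card := by
        rw [Finset.card_erase_of_mem (Finset.mem_univ i), Finset.card_univ,
          ← Nat.card_eq_fintype_card]
        omega
      obtain ⟨j, hj, l, hl, hjl⟩ := Finset.one_lt_card.1 h
      exact ⟨j, l, Finset.ne_of_mem_erase hj, Finset.ne_of_mem_erase hl, hjl⟩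
    refine Subgroup.commutator_le.2 fun u hu v hv => ?_
    change (Pi.mulSingle i ⁅u, v⁆ : C → A) ∈ T
    rw [← commutatorElement_mulSingle_div hj.symm hl.symm hjl]
    have hu' : Pi.mulSingle i u / Pi.mulSingle j u ∈ T :=
      one_baseHom_mulSingle_div_mem hcop hinf hsup hu i j
    have hv' : Pi.mulSingle i v / Pi.mulSingle l v ∈ T :=
      one_baseHom_mulSingle_div_mem hcop hinf hsup hv i l
    exact T.mul_mem (T.mul_mem (T.mul_mem hu' hv') (T.inv_mem hu')) (T.inv_mem hv')
  have hdiag : ((1, baseHom fun _ => γ ^ k) : A × (A ≀ᵣ C)) ∈ K :=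
    Subgroup.pi_mem_of_mulSingle_mem (H := T) (fun _ => γ ^ k) fun i => hsingle i hγ
  obtain ⟨δ, hδ, hK⟩ := hsup (γ, baseHom fun _ => γ) fun i => rfl
  refine ⟨δ, hδ, hinf _ ?_ ?_⟩
  · have h : (δ : A ⧸ I) = 1 := (QuotientGroup.eq_one_iff _).2 hδ
    rw [← QuotientGroup.eq_one_iff, QuotientGroup.mk_pow, QuotientGroup.mk_mul, h, one_mul,
      ← QuotientGroup.mk_pow, QuotientGroup.eq_one_iff]
    exact Subgroup.commutator_le_left I I hγ
  · have h := K.div_mem (K.pow_mem hK k) hdiag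
    rw [Prod.pow_mk, Prod.mk_div_mk, ← map_pow, div_one] at h
    convert h using 2
    exact (div_self' _).symm

end FiberWreath

instance MulAut.normal_range_conj (N : Type*) [Group N] :
    (MulAut.conj : N →* MulAut N).range.Normal where
  conj_mem := by
    rintro _ ⟨n, rfl⟩ g
    exact ⟨g n, by ext; simp⟩

/-- Let `N` be a finite group with trivial center. If there are `k ≥ 1` and
`γ ∈ Aut(N)` with `γ^k ∈ Inn(N)'` and `(δγ)^k ≠ 1` for all `δ ∈ Inn(N)`, then
Gaschütz' theorem does not hold for `N`. -/
theorem not_gaschuetz_of_aut (N : Type u) [Group N] [Finite N]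
    (hz : Subgroup.center N = ⊥) (k : ℕ) (hk : 0 < k) (γ : MulAut N)
    (h1 : γ ^ k ∈ ⁅((MulAut.conj : N →* MulAut N).range),
      ((MulAut.conj : N →* MulAut N).range)⁆)
    (h2 : ∀ δ ∈ (MulAut.conj : N →* MulAut N).range, (δ * γ) ^ k ≠ 1) :
    ¬ GaschuetzHolds N := by
  intro hG
  let I : Subgroup (MulAut N) := (MulAut.conj : N →* MulAut N).range
  let r := 2 * Nat.card N + 1
  let C := Multiplicative (ZMod r)
  have : Finite C := inferInstanceAs (Finite (ZMod r))
  have hC : Nat.card C = r := Nat.card_zmod r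
  have hcop : (Nat.card N).Coprime (Nat.card C) := by
    rw [hC]; simp [r]
  have : Finite (MulAut N) := Finite.of_injective _ DFunLike.coe_injective
  have hconj (n : N) : ((MulAut.conj n : MulAut N) : MulAut N ⧸ I) = 1 :=
    (QuotientGroup.eq_one_iff _).2 ⟨n, rfl⟩
  let f : N →* fiberWreath I C :=
    ((MonoidHom.inl (MulAut N) (MulAut N ≀ᵣ C)).comp MulAut.conj).codRestrict _
      fun n i => hconj n
  have hfrange (g : fiberWreath I C) : g ∈ f.range ↔ g.1.2 = 1 := by
    refine ⟨fun ⟨n, hn⟩ => hn ▸ rfl, fun hg => ?_⟩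
    have h := mem_fiberWreath.1 g.2 1
    rw [hg, one_left, Pi.one_apply, QuotientGroup.mk_one, QuotientGroup.eq_one_iff] at h
    obtain ⟨n, hn⟩ := h
    exact ⟨n, Subtype.ext (Prod.ext hn hg.symm)⟩
  have hfinj : Function.Injective f := by
    refine (injective_iff_map_eq_one f).2 fun n hn => ?_
    have hn' : MulAut.conj n = 1 := congrArg (fun g => g.1.1) hn
    rw [← Subgroup.mem_bot, ← hz, Subgroup.mem_center_iff]
    intro m
    have := DFunLike.congr_fun hn' m
    rw [MulAut.conj_apply, MulAut.one_apply, mul_inv_eq_iff_eq_mul] at this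
    exact this.symm
  have hfnormal : f.range.Normal := by
    refine ⟨fun n hn g => ?_⟩
    rw [hfrange] at hn ⊢
    simp [hn]
  let ρ : fiberWreath I C →* C :=
    rightHom.comp ((MonoidHom.snd _ _).comp (fiberWreath I C).subtype)
  have hρ (g : fiberWreath I C) : ρ g = g.1.2.right := rfl
  have hindex : ρ.ker.index = Nat.card C := by
    rw [Subgroup.index_ker, MonoidHom.range_eq_top.2 fun c => ⟨⟨(1, inl c), fun _ => rfl⟩, rfl⟩,
      Subgroup.card_top]
  have hcompl : HasComplementIn f.range ρ.ker := by
    let L : Subgroup (fiberWreath I C) :=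
      { carrier := {g | g.1.2.right = 1 ∧ g.1.1 = g.1.2.left 1}
        one_mem' := ⟨rfl, rfl⟩
        mul_mem' := fun ⟨hx, hx'⟩ ⟨hy, hy'⟩ => by simp [hx, hx', hy, hy']
        inv_mem' := fun ⟨hx, hx'⟩ => by simp [hx, hx'] }
    refine ⟨L, fun g hg => hg.1, ?_, ?_⟩
    · refine (Subgroup.eq_bot_iff_forall _).2 fun g ⟨hg, hg'⟩ => ?_
      have h := (hfrange g).1 hg'
      exact Subtype.ext (Prod.ext (by rw [hg.2, h]; rfl) h)
    · ext g
      refine ⟨?_, fun hg => ?_⟩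
      · rintro ⟨a, ha, b, hb, rfl⟩
        change ρ (a * b) = 1
        rw [map_mul, hρ, hρ, ha.1, (hfrange b).1 hb, one_right, one_mul]
      · let a : fiberWreath I C := ⟨(g.1.2.left 1, g.1.2), fun i =>
          (mem_fiberWreath.1 g.2 1).symm.trans (mem_fiberWreath.1 g.2 i)⟩
        refine ⟨a, ⟨hg, rfl⟩, a⁻¹ * g, (hfrange _).2 ?_, mul_inv_cancel_left a g⟩
        exact inv_mul_cancel g.1.2
  obtain ⟨K, -, hinf, hsup⟩ := hG _ f ρ.ker hfinj hfnormal
    (fun g hg => by rw [MonoidHom.mem_ker, hρ, (hfrange g).1 hg, one_right])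
    (hindex ▸ hcop) hcompl
  have hI : (Nat.card I).Coprime (Nat.card C) :=
    hcop.coprime_dvd_left (Subgroup.card_range_dvd _)
  obtain ⟨δ, hδ, h⟩ : ∃ δ ∈ I, (δ * γ) ^ k = 1 := by
    refine exists_mul_pow_eq_one_of_complement (K := K.map (fiberWreath I C).subtype)
      (by have := Nat.card_pos (α := N); omega) hI ?_ ?_ h1
    · rintro a - ⟨g, hg, hga⟩
      have hgb : g ∈ K ⊓ f.range := ⟨hg, (hfrange g).2 (congrArg Prod.snd hga)⟩
      rw [hinf, Subgroup.mem_bot] at hgb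
      rw [hgb] at hga
      exact (congrArg Prod.fst hga).symm
    · intro p hp
      obtain ⟨κ, hκ, _, ⟨n, rfl⟩, hκn⟩ := hsup.ge (Set.mem_univ (⟨p, hp⟩ : fiberWreath I C))
      have hval : κ.1 * (MulAut.conj n, 1) = p := congrArg Subtype.val hκn
      refine ⟨MulAut.conj (p.1 n⁻¹), ⟨_, rfl⟩, κ, hκ, ?_⟩
      rw [← hval]
      refine Prod.ext ?_ (mul_one _).symm
      ext m
      simp [mul_assoc]
  exact h2 δ hδ h
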